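/- Let G be an L⁰-convexly compact subset of L⁰(𝓕,B) and T : G → G a nonexpansive mapping. For m ∈ ℕ let T^m(G) denote the image of G under the m-th iterate of T, and define AR(x) := inf_{m∈ℕ} R(T^m(G), x) for x ∈ G, AR(G) := inf{AR(x) : x ∈ G}, and AC := {x ∈ G : AR(x) = AR(G)} (the random asymptotic center of the decreasing sequence {T^m(G)} with respect to G). Then AC is a nonempty closed L⁰-convex subset of G and T(AC) ⊆ AC. -/

import Mathlib

open MeasureTheory Set Filter Function
open scoped Classical

noncomputable section

namespace RNM


variable {Ω : Type*} [MeasurableSpace Ω] {P : Measure Ω}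
variable {B : Type*} [NormedAddCommGroup B] [NormedSpace ℝ B]

/-- The pointwise norm of `x ∈ L⁰(𝓕,B)` as an element of `L⁰(𝓕,ℝ)`. -/
def nrm (x : Ω →ₘ[P] B) : Ω →ₘ[P] ℝ := x.comp norm continuous_norm

/-- The module action of `L⁰(𝓕,ℝ)` on `L⁰(𝓕,B)` (pointwise scalar multiplication). -/
def msmul (l : Ω →ₘ[P] ℝ) (x : Ω →ₘ[P] B) : Ω →ₘ[P] B :=
  AEEqFun.comp₂ (fun c (b : B) => c • b) continuous_smul l x

/-- `Ĩ_A`, the equivalence class of the indicator function of `A`, in `L⁰(𝓕,ℝ)`. -/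
def ind (A : Set Ω) (hA : MeasurableSet A) : Ω →ₘ[P] ℝ :=
  AEEqFun.mk (A.indicator fun _ => (1 : ℝ))
    ((measurable_const.indicator hA).aestronglyMeasurable)

/-- A subset of `L⁰(𝓕,B)` is a.s. bounded if the norms of its members have a common
bound in `L⁰(𝓕,ℝ)`. -/
def ASBounded (H : Set (Ω →ₘ[P] B)) : Prop :=
  ∃ ξ : Ω →ₘ[P] ℝ, ∀ h ∈ H, nrm h ≤ ξ

/-- The supremum of a subset of `L⁰(𝓕,ℝ)` (junk value `0` if no least upper bound exists;
for nonempty a.s. bounded-above sets the least upper bound always exists, by Dedekind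
completeness of `L⁰(𝓕,ℝ)`). -/
def lsup (S : Set (Ω →ₘ[P] ℝ)) : Ω →ₘ[P] ℝ :=
  if h : ∃ ξ, IsLUB S ξ then h.choose else 0

/-- The infimum of a subset of `L⁰(𝓕,ℝ)` (junk value `0` if no greatest lower bound exists). -/
def linf (S : Set (Ω →ₘ[P] ℝ)) : Ω →ₘ[P] ℝ :=
  if h : ∃ ξ, IsGLB S ξ then h.choose else 0

/-- The random Chebyshev radius `R(H,x)` of `H` at `x`. -/
def Rr (H : Set (Ω →ₘ[P] B)) (x : Ω →ₘ[P] B) : Ω →ₘ[P] ℝ :=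
  lsup ((fun y => nrm (x - y)) '' H)

/-- The random Chebyshev radius `R(H,G)` of `H` with respect to `G`. -/
def RrS (H G : Set (Ω →ₘ[P] B)) : Ω →ₘ[P] ℝ :=
  linf ((fun x => Rr H x) '' G)

/-- The random Chebyshev center `C(H,G)` of `H` with respect to `G`. -/
def Cc (H G : Set (Ω →ₘ[P] B)) : Set (Ω →ₘ[P] B) :=
  {x ∈ G | Rr H x = RrS H G}

/-- The random diameter `D(H)`. -/
def Dd (H : Set (Ω →ₘ[P] B)) : Ω →ₘ[P] ℝ :=
  lsup {ξ | ∃ x ∈ H, ∃ y ∈ H, ξ = nrm (x - y)}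

/-- A subset of `L⁰(𝓕,B)` is closed if it is sequentially closed under convergence in
probability (the `(ε,λ)`-topology). -/
def SeqClosed (S : Set (Ω →ₘ[P] B)) : Prop :=
  ∀ (x : ℕ → Ω →ₘ[P] B) (y : Ω →ₘ[P] B), (∀ n, x n ∈ S) →
    TendstoInMeasure P (fun n => (x n : Ω → B)) atTop y → y ∈ S

/-- The closure of a subset of `L⁰(𝓕,B)` under convergence in probability. -/
def seqClosure (S : Set (Ω →ₘ[P] B)) : Set (Ω →ₘ[P] B) :=
  {y | ∃ x : ℕ → Ω →ₘ[P] B, (∀ n, x n ∈ S) ∧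
    TendstoInMeasure P (fun n => (x n : Ω → B)) atTop y}

/-- `L⁰`-convexity. -/
def LConvex (G : Set (Ω →ₘ[P] B)) : Prop :=
  ∀ x ∈ G, ∀ y ∈ G, ∀ l : Ω →ₘ[P] ℝ, 0 ≤ l → l ≤ 1 →
    msmul l x + msmul (1 - l) y ∈ G

/-- `L⁰`-convex compactness: `G` is a nonempty closed `L⁰`-convex set such that every family
of nonempty closed `L⁰`-convex subsets of `G` with the finite intersection property has
nonempty intersection. -/
def ConvexlyCompact (G : Set (Ω →ₘ[P] B)) : Prop :=
  G.Nonempty ∧ SeqClosed G ∧ LConvex G ∧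
    ∀ 𝒞 : Set (Set (Ω →ₘ[P] B)),
      (∀ C ∈ 𝒞, C.Nonempty ∧ C ⊆ G ∧ SeqClosed C ∧ LConvex C) →
      (∀ S : Finset (Set (Ω →ₘ[P] B)), ↑S ⊆ 𝒞 → (⋂₀ (S : Set (Set (Ω →ₘ[P] B)))).Nonempty) →
      (⋂₀ 𝒞).Nonempty

/-- Random normal structure. -/
def RandNormalStructure (G : Set (Ω →ₘ[P] B)) : Prop :=
  ∀ H ⊆ G, H.Nonempty → ASBounded H → SeqClosed H → LConvex H → Dd H ≠ 0 →
    ∃ z ∈ H, ∀ᵐ ω ∂P, 0 < Dd H ω → Rr H z ω < Dd H ω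

/-- A nonexpansive mapping (on `G`). -/
def NonexpansiveOn (G : Set (Ω →ₘ[P] B)) (T : (Ω →ₘ[P] B) → (Ω →ₘ[P] B)) : Prop :=
  ∀ x ∈ G, ∀ y ∈ G, nrm (T x - T y) ≤ nrm (x - y)

/-- An isometric mapping (on `G`). -/
def IsometricOn (G : Set (Ω →ₘ[P] B)) (T : (Ω →ₘ[P] B) → (Ω →ₘ[P] B)) : Prop :=
  ∀ x ∈ G, ∀ y ∈ G, nrm (T x - T y) = nrm (x - y)

/-- A countable measurable partition of `Ω`. -/
def IsPartition (A : ℕ → Set Ω) : Prop :=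
  (∀ n, MeasurableSet (A n)) ∧ Pairwise (Disjoint on A) ∧ (⋃ n, A n) = univ

/-- `y` is the countable concatenation `Σ_n Ĩ_{A_n} x_n`,
i.e. `y` agrees a.s. with `x n` on `A n` for each `n`. -/
def IsConcat (A : ℕ → Set Ω) (x : ℕ → Ω →ₘ[P] B) (y : Ω →ₘ[P] B) : Prop :=
  ∀ n, ∀ᵐ ω ∂P, ω ∈ A n → y ω = x n ω

/-- `G` is σ-stable: it contains all countable concatenations of its members along
countable measurable partitions of `Ω`. -/
def SigmaStable (G : Set (Ω →ₘ[P] B)) : Prop :=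
  ∀ A : ℕ → Set Ω, IsPartition A → ∀ x : ℕ → Ω →ₘ[P] B, (∀ n, x n ∈ G) →
    ∀ y, IsConcat A x y → y ∈ G

/-- The σ-stable hull of `G`. -/
def sigmaHull (G : Set (Ω →ₘ[P] B)) : Set (Ω →ₘ[P] B) :=
  {y | ∃ A : ℕ → Set Ω, IsPartition A ∧
    ∃ x : ℕ → Ω →ₘ[P] B, (∀ n, x n ∈ G) ∧ IsConcat A x y}

/-- The countable concatenation `Σ_n Ĩ_{A_n} H_n` of a sequence of sets. -/
def concatSet (A : ℕ → Set Ω) (H : ℕ → Set (Ω →ₘ[P] B)) : Set (Ω →ₘ[P] B) :=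
  {y | ∃ x : ℕ → Ω →ₘ[P] B, (∀ n, x n ∈ H n) ∧ IsConcat A x y}

/-- A finitely stable subset of `L⁰(𝓕,B)`. -/
def FinStable (G : Set (Ω →ₘ[P] B)) : Prop :=
  ∀ x ∈ G, ∀ y ∈ G, ∀ A : Set Ω, ∀ hA : MeasurableSet A,
    msmul (ind A hA) x + msmul (ind Aᶜ hA.compl) y ∈ G


variable {Ω : Type*} [MeasurableSpace Ω] {P : Measure Ω}
variable {B : Type*} [NormedAddCommGroup B] [NormedSpace ℝ B]

/-- The random asymptotic radius `AR(𝓔,x)` of the decreasing sequence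
`𝓔 = {T^m(G) : m ∈ ℕ}` at `x`. -/
def asympR (G : Set (Ω →ₘ[P] B)) (T : (Ω →ₘ[P] B) → (Ω →ₘ[P] B))
    (x : Ω →ₘ[P] B) : Ω →ₘ[P] ℝ :=
  linf {ξ | ∃ m : ℕ, ξ = Rr (T^[m + 1] '' G) x}

/-- The random asymptotic radius `AR(𝓔,G)`. -/
def asympRS (G : Set (Ω →ₘ[P] B)) (T : (Ω →ₘ[P] B) → (Ω →ₘ[P] B)) : Ω →ₘ[P] ℝ :=
  linf ((fun x => asympR G T x) '' G)

/-- The random asymptotic center `AC(𝓔,G)`. -/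
def asympC (G : Set (Ω →ₘ[P] B)) (T : (Ω →ₘ[P] B) → (Ω →ₘ[P] B)) :
    Set (Ω →ₘ[P] B) :=
  {x ∈ G | asympR G T x = asympRS G T}

/-! ### Pointwise description of the operations -/

lemma nrm_coe (x : Ω →ₘ[P] B) : ∀ᵐ ω ∂P, nrm x ω = ‖x ω‖ :=
  AEEqFun.coeFn_comp _ _ x

lemma nrm_sub_coe (x y : Ω →ₘ[P] B) : ∀ᵐ ω ∂P, nrm (x - y) ω = ‖x ω - y ω‖ := by
  filter_upwards [nrm_coe (x - y), AEEqFun.coeFn_sub x y] with ω h1 h2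
  rw [h1, h2]; rfl

lemma comb_coe (l : Ω →ₘ[P] ℝ) (x y : Ω →ₘ[P] B) :
    ∀ᵐ ω ∂P, (msmul l x + msmul (1 - l) y) ω = l ω • x ω + (1 - l ω) • y ω := by
  have h3 : ∀ᵐ ω ∂P, (msmul l x) ω = l ω • x ω := AEEqFun.coeFn_comp₂ _ _ l x
  have h4 : ∀ᵐ ω ∂P, (msmul (1 - l) y) ω = (1 - l) ω • y ω := AEEqFun.coeFn_comp₂ _ _ _ y
  filter_upwards [AEEqFun.coeFn_add (msmul l x) (msmul (1 - l) y), h3, h4,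
    AEEqFun.coeFn_sub (1 : Ω →ₘ[P] ℝ) l, AEEqFun.coeFn_one (α := Ω) (μ := P) (β := ℝ)]
    with ω h1 h3 h4 h5 h6
  rw [h1, Pi.add_apply, h3, h4, h5, Pi.sub_apply, h6]; rfl

lemma zero_le_one_coe (l : Ω →ₘ[P] ℝ) (h0 : 0 ≤ l) (h1 : l ≤ 1) :
    ∀ᵐ ω ∂P, 0 ≤ l ω ∧ l ω ≤ 1 := by
  filter_upwards [AEEqFun.coeFn_le.2 h0, AEEqFun.coeFn_le.2 h1,
    AEEqFun.coeFn_one (α := Ω) (μ := P) (β := ℝ), AEEqFun.coeFn_zero (α := Ω) (μ := P) (β := ℝ)]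
    with ω h0 h1 h2 h3
  rw [h2] at h1
  rw [h3] at h0
  exact ⟨h0, h1⟩

/-- Concatenation of two members along a measurable set. -/
lemma concat_two {G : Set (Ω →ₘ[P] B)} (hc : LConvex G) {x y : Ω →ₘ[P] B}
    (hx : x ∈ G) (hy : y ∈ G) {A : Set Ω} (hA : MeasurableSet A) :
    ∃ w ∈ G, ∀ᵐ ω ∂P, w ω = if ω ∈ A then x ω else y ω := by
  have hi : ∀ᵐ ω ∂P, (ind (P := P) A hA) ω = A.indicator (fun _ => (1 : ℝ)) ω :=
    AEEqFun.coeFn_mk _ _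
  have h0 : (0 : Ω →ₘ[P] ℝ) ≤ ind A hA := by
    rw [← AEEqFun.coeFn_le]
    filter_upwards [hi, AEEqFun.coeFn_zero (α := Ω) (μ := P) (β := ℝ)] with ω h1 h2
    rw [h1, h2]
    exact Set.indicator_nonneg (fun _ _ => zero_le_one) _
  have h1 : ind A hA ≤ (1 : Ω →ₘ[P] ℝ) := by
    rw [← AEEqFun.coeFn_le]
    filter_upwards [hi, AEEqFun.coeFn_one (α := Ω) (μ := P) (β := ℝ)] with ω h1 h2
    rw [h1, h2]
    by_cases h : ω ∈ A <;> simp [h]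
  refine ⟨_, hc x hx y hy (ind A hA) h0 h1, ?_⟩
  filter_upwards [hi, comb_coe (ind A hA) x y] with ω h2 h3
  rw [h3, h2]
  by_cases h : ω ∈ A <;> simp [h]

/-- Countable concatenation. -/
lemma concat_seq [IsProbabilityMeasure P] {G : Set (Ω →ₘ[P] B)} (hcl : SeqClosed G)
    (hc : LConvex G) (x : ℕ → Ω →ₘ[P] B) (hx : ∀ n, x n ∈ G) (N : Ω → ℕ) (hN : Measurable N) :
    ∃ y ∈ G, ∀ᵐ ω ∂P, y ω = x (N ω) ω := by
  have key : ∀ n : ℕ, ∃ w ∈ G, ∀ᵐ ω ∂P, w ω = if N ω ≤ n then x (N ω) ω else x 0 ω := by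
    intro n
    induction n with
    | zero =>
      refine ⟨x 0, hx 0, Eventually.of_forall fun ω => ?_⟩
      split_ifs with h
      · rw [Nat.le_zero.1 h]
      · rfl
    | succ n ih =>
      obtain ⟨w, hw, hw'⟩ := ih
      obtain ⟨v, hv, hv'⟩ := concat_two hc (hx (n + 1)) hw
        (hN (measurableSet_singleton (n + 1)))
      refine ⟨v, hv, ?_⟩
      filter_upwards [hw', hv'] with ω h1 h2
      rw [h2, h1]
      by_cases h : N ω = n + 1
      · simp [h]
      · have : N ω ≤ n ↔ N ω ≤ n + 1 := by omega
        simp [h, this]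
  choose w hw hw' using key
  have hlim : ∀ᵐ ω ∂P, Tendsto (fun n => w n ω) atTop (nhds (x (N ω) ω)) := by
    filter_upwards [ae_all_iff.2 hw'] with ω h
    refine tendsto_const_nhds.congr' ?_
    filter_upwards [eventually_ge_atTop (N ω)] with n hn
    rw [h n, if_pos hn]
  have hm : AEStronglyMeasurable (fun ω => x (N ω) ω) P :=
    aestronglyMeasurable_of_tendsto_ae atTop (fun n => (w n).aestronglyMeasurable) hlim
  have hmk : ∀ᵐ ω ∂P, (AEEqFun.mk _ hm) ω = x (N ω) ω := AEEqFun.coeFn_mk _ hm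
  refine ⟨AEEqFun.mk _ hm, hcl w _ hw ?_, hmk⟩
  refine tendstoInMeasure_of_tendsto_ae (fun n => (w n).aestronglyMeasurable) ?_
  filter_upwards [hmk, hlim] with ω h1 h2
  rw [h1]; exact h2

/-! ### Order completeness of `L⁰` -/

lemma exists_seq_dominating [IsProbabilityMeasure P] (S : Set (Ω →ₘ[P] ℝ)) (hne : S.Nonempty)
    (hdir : DirectedOn (· ≤ ·) S) :
    ∃ s : ℕ → Ω →ₘ[P] ℝ, (∀ n, s n ∈ S) ∧
      ∀ t ∈ S, ∀ᵐ ω ∂P, ∀ c < t ω, ∃ n, c < s n ω := by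
  have hmeas : ∀ t : Ω →ₘ[P] ℝ, Measurable fun ω => Real.arctan (t ω) := fun t =>
    Real.continuous_arctan.measurable.comp t.measurable
  have hbd : ∀ r : ℝ, ‖Real.arctan r‖ ≤ 2 := fun r => by
    rw [Real.norm_eq_abs, abs_le]
    have := Real.arctan_lt_pi_div_two r
    have := Real.neg_pi_div_two_lt_arctan r
    have := Real.pi_lt_four
    constructor <;> linarith
  have hintg : ∀ t : Ω →ₘ[P] ℝ, Integrable (fun ω => Real.arctan (t ω)) P := fun t =>
    Integrable.of_bound (hmeas t).aestronglyMeasurable 2 (Eventually.of_forall fun ω => hbd _)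
  set φ : (Ω →ₘ[P] ℝ) → ℝ := fun t => ∫ ω, Real.arctan (t ω) ∂P with hφ
  have hφb : BddAbove (φ '' S) := by
    refine ⟨2, ?_⟩
    rintro _ ⟨t, -, rfl⟩
    have := norm_integral_le_of_norm_le_const (μ := P) (f := fun ω => Real.arctan (t ω))
      (Eventually.of_forall fun ω => hbd _)
    simp at this
    exact (le_abs_self _).trans this
  have hex : ∀ n : ℕ, ∃ t ∈ S, sSup (φ '' S) - 1 / ((n : ℝ) + 1) < φ t := by
    intro n
    have hpos : (0 : ℝ) < 1 / ((n : ℝ) + 1) := by positivity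
    obtain ⟨_, ⟨t, ht, rfl⟩, h⟩ := exists_lt_of_lt_csSup (hne.image φ) (sub_lt_self _ hpos)
    exact ⟨t, ht, h⟩
  choose s hs hs' using hex
  refine ⟨s, hs, fun t ht => ?_⟩
  set e : ℕ → Ω → ENNReal := fun n ω =>
    ENNReal.ofReal (Real.arctan (max (t ω) (s n ω)) - Real.arctan (s n ω)) with he
  have hem : ∀ n, Measurable (e n) := fun n =>
    ((Real.continuous_arctan.measurable.comp (t.measurable.max (s n).measurable)).sub
      (hmeas (s n))).ennreal_ofReal
  have hle : ∀ n, ∫⁻ ω, e n ω ∂P ≤ ENNReal.ofReal (1 / ((n : ℝ) + 1)) := by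
    intro n
    obtain ⟨u, hu, htu, hsu⟩ := hdir t ht (s n) (hs n)
    have h1 : ∀ᵐ ω ∂P, t ω ≤ u ω := AEEqFun.coeFn_le.2 htu
    have h2 : ∀ᵐ ω ∂P, s n ω ≤ u ω := AEEqFun.coeFn_le.2 hsu
    calc ∫⁻ ω, e n ω ∂P
        ≤ ∫⁻ ω, ENNReal.ofReal (Real.arctan (u ω) - Real.arctan (s n ω)) ∂P := by
          refine lintegral_mono_ae ?_
          filter_upwards [h1, h2] with ω h1 h2
          refine ENNReal.ofReal_le_ofReal ?_
          have := Real.arctan_mono (max_le h1 h2)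
          linarith
      _ = ENNReal.ofReal (∫ ω, (Real.arctan (u ω) - Real.arctan (s n ω)) ∂P) := by
          refine (ofReal_integral_eq_lintegral_ofReal ((hintg u).sub (hintg (s n))) ?_).symm
          filter_upwards [h2] with ω h2
          exact sub_nonneg.2 (Real.arctan_mono h2)
      _ ≤ _ := by
          refine ENNReal.ofReal_le_ofReal ?_
          rw [integral_sub (hintg u) (hintg (s n))]
          have h3 : φ u ≤ sSup (φ '' S) := le_csSup hφb ⟨u, hu, rfl⟩
          have h4 := hs' n
          simp only [hφ] at h3 h4 ⊢
          linarith
  have h0 : ∫⁻ ω, ⨅ n, e n ω ∂P = 0 := by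
    refine le_antisymm ?_ bot_le
    have ht0 : Tendsto (fun n : ℕ => ENNReal.ofReal (1 / ((n : ℝ) + 1))) atTop (nhds 0) := by
      have := ENNReal.tendsto_ofReal (tendsto_one_div_add_atTop_nhds_zero_nat (𝕜 := ℝ))
      simpa using this
    refine ge_of_tendsto' ht0 fun n => ?_
    exact (lintegral_mono fun ω => iInf_le _ n).trans (hle n)
  rw [lintegral_eq_zero_iff (Measurable.iInf hem)] at h0
  filter_upwards [h0] with ω h c hc
  have hpos : 0 < ENNReal.ofReal (Real.arctan (t ω) - Real.arctan c) :=
    ENNReal.ofReal_pos.2 (sub_pos.2 (Real.arctan_strictMono hc))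
  have h' : ⨅ n, e n ω = 0 := h
  rw [← h', iInf_lt_iff] at hpos
  obtain ⟨n, hn⟩ := hpos
  refine ⟨n, ?_⟩
  have hn' := (ENNReal.ofReal_lt_ofReal_iff_of_nonneg
    (sub_nonneg.2 (Real.arctan_mono (le_max_right _ _)))).1 hn
  have h5 := Real.arctan_mono (le_max_left (t ω) (s n ω))
  exact Real.arctan_strictMono.lt_iff_lt.1 (by linarith)

lemma exists_isLUB [IsProbabilityMeasure P] (S : Set (Ω →ₘ[P] ℝ)) (hne : S.Nonempty)
    (hb : BddAbove S) : ∃ ξ, IsLUB S ξ := by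
  obtain ⟨s, hs, hdom⟩ := exists_seq_dominating (supClosure S) (hne.mono subset_supClosure)
    supClosed_supClosure.directedOn
  have hm : AEStronglyMeasurable (fun ω => ⨆ n, s n ω) P :=
    (Measurable.iSup fun n => (s n).measurable).aestronglyMeasurable
  have hmk : ∀ᵐ ω ∂P, (AEEqFun.mk _ hm) ω = ⨆ n, s n ω := AEEqFun.coeFn_mk _ hm
  refine ⟨AEEqFun.mk _ hm, isLUB_supClosure.1 ⟨fun t ht => ?_, fun u hu => ?_⟩⟩
  · obtain ⟨u, hu⟩ := hb
    rw [← upperBounds_supClosure] at hu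
    rw [← AEEqFun.coeFn_le]
    filter_upwards [hmk, hdom t ht,
      ae_all_iff.2 fun n => AEEqFun.coeFn_le.2 (hu (hs n))] with ω h1 h2 h3
    rw [h1]
    refine le_of_forall_lt fun c hc => ?_
    obtain ⟨n, hn⟩ := h2 c hc
    exact hn.trans_le (le_ciSup (f := fun n => s n ω)
      ⟨u ω, by rintro _ ⟨n, rfl⟩; exact h3 n⟩ n)
  · rw [← AEEqFun.coeFn_le]
    filter_upwards [hmk, ae_all_iff.2 fun n => AEEqFun.coeFn_le.2 (hu (hs n))] with ω h1 h3
    rw [h1]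
    exact ciSup_le h3

lemma exists_isGLB [IsProbabilityMeasure P] (S : Set (Ω →ₘ[P] ℝ)) (hne : S.Nonempty)
    (hb : BddBelow S) : ∃ ξ, IsGLB S ξ := by
  obtain ⟨ξ, h⟩ := exists_isLUB (lowerBounds S) hb hne.bddAbove_lowerBounds
  exact ⟨ξ, isLUB_lowerBounds.1 h⟩

lemma lsup_isLUB [IsProbabilityMeasure P] (S : Set (Ω →ₘ[P] ℝ)) (hne : S.Nonempty)
    (hb : BddAbove S) : IsLUB S (lsup S) := by
  have h := exists_isLUB S hne hb
  rw [lsup, dif_pos h]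
  exact h.choose_spec

lemma linf_isGLB [IsProbabilityMeasure P] (S : Set (Ω →ₘ[P] ℝ)) (hne : S.Nonempty)
    (hb : BddBelow S) : IsGLB S (linf S) := by
  have h := exists_isGLB S hne hb
  rw [linf, dif_pos h]
  exact h.choose_spec

/-! ### Convex compactness for directed families -/

lemma ConvexlyCompact.directed_inter {G : Set (Ω →ₘ[P] B)} (hG : ConvexlyCompact G)
    {ι : Type*} [Nonempty ι] (C : ι → Set (Ω →ₘ[P] B))
    (hC : ∀ i, (C i).Nonempty ∧ C i ⊆ G ∧ SeqClosed (C i) ∧ LConvex (C i))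
    (hdir : ∀ i j, ∃ k, C k ⊆ C i ∧ C k ⊆ C j) : ∃ z, ∀ i, z ∈ C i := by
  obtain ⟨z, hz⟩ := hG.2.2.2 (Set.range C) (by rintro _ ⟨i, rfl⟩; exact hC i) (by
    intro S
    suffices h : ↑S ⊆ Set.range C → ∃ k, C k ⊆ ⋂₀ (S : Set (Set (Ω →ₘ[P] B))) by
      intro hS
      obtain ⟨k, hk⟩ := h hS
      exact (hC k).1.mono hk
    induction S using Finset.induction_on with
    | empty => intro _; exact ⟨Classical.arbitrary ι, by simp⟩
    | insert D S _ ih =>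
      intro hS
      rw [Finset.coe_insert, Set.insert_subset_iff] at hS
      obtain ⟨k, hk⟩ := ih hS.2
      obtain ⟨i, rfl⟩ := hS.1
      obtain ⟨j, h1, h2⟩ := hdir i k
      refine ⟨j, ?_⟩
      rw [Finset.coe_insert, Set.sInter_insert]
      exact Set.subset_inter h1 (h2.trans hk))
  exact ⟨z, fun i => hz _ ⟨i, rfl⟩⟩

/-! ### Almost sure boundedness of convexly compact sets -/

/-- A countably valued almost norming functional. -/
lemma exists_norming (x : Ω → B) (hx : StronglyMeasurable x) :
    ∃ f : Ω → (B →L[ℝ] ℝ), StronglyMeasurable f ∧ (∀ ω, ‖f ω‖ ≤ 1) ∧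
      ∀ ω, ‖x ω‖ - 1 ≤ f ω (x ω) := by
  rcases isEmpty_or_nonempty Ω with hΩ | ⟨⟨ω₀⟩⟩
  · exact ⟨fun _ => 0, stronglyMeasurable_const, fun ω => (hΩ.false ω).elim,
      fun ω => (hΩ.false ω).elim⟩
  obtain ⟨c, hc, hcl⟩ := hx.isSeparable_range
  have hcne : c.Nonempty := by
    rw [← closure_nonempty_iff]
    exact ⟨x ω₀, hcl ⟨ω₀, rfl⟩⟩
  obtain ⟨d, rfl⟩ := hc.exists_eq_range hcne
  have hp : ∀ ω, ∃ j, ‖x ω - d j‖ < 1 / 2 := by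
    intro ω
    obtain ⟨_, ⟨j, rfl⟩, hj⟩ := Metric.mem_closure_iff.1 (hcl ⟨ω, rfl⟩) (1 / 2) (by norm_num)
    exact ⟨j, by rwa [← dist_eq_norm]⟩
  choose φ hφ hφ' using fun j => exists_dual_vector'' ℝ (d j)
  have hmeas : Measurable fun ω => Nat.find (hp ω) := measurable_find hp fun k =>
    measurableSet_lt (hx.sub stronglyMeasurable_const).norm.measurable measurable_const
  refine ⟨fun ω => φ (Nat.find (hp ω)),
    (StronglyMeasurable.of_discrete (f := φ)).comp_measurable hmeas, fun ω => hφ _, fun ω => ?_⟩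
  have h1 := Nat.find_spec (hp ω)
  set j := Nat.find (hp ω)
  have h2 : ‖φ j (x ω - d j)‖ ≤ ‖x ω - d j‖ := by
    refine ((φ j).le_opNorm _).trans ?_
    exact mul_le_of_le_one_left (norm_nonneg _) (hφ j)
  rw [map_sub, hφ' j, Real.norm_eq_abs] at h2
  have h3 := norm_sub_norm_le (x ω) (d j)
  have h4 := neg_le_of_abs_le h2
  simp only [RCLike.ofReal_real_eq_id, id] at h4
  linarith

/-- Random gliding hump. -/
lemma exists_functional (x : ℕ → Ω → B) (hx : ∀ k, StronglyMeasurable (x k)) :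
    ∃ h : Ω → (B →L[ℝ] ℝ), StronglyMeasurable h ∧
      ∀ k ω, (1 / 3 : ℝ) ^ k * (‖x k ω‖ / 2 - 1) ≤ |h ω (x k ω)| := by
  choose f hf hf1 hfx using fun k => exists_norming (x k) (hx k)
  let g : ℕ → Ω → (B →L[ℝ] ℝ) := fun n => Nat.rec (fun _ => 0)
    (fun k gk ω => gk ω + ((if 0 ≤ gk ω (x k ω) then (1 : ℝ) else -1) * (1 / 3 : ℝ) ^ k) • f k ω) n
  have hg : ∀ k ω, g (k + 1) ω = g k ω +
    ((if 0 ≤ g k ω (x k ω) then (1 : ℝ) else -1) * (1 / 3 : ℝ) ^ k) • f k ω := fun _ _ => rfl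
  have hgm : ∀ k, StronglyMeasurable (g k) := by
    intro k
    induction k with
    | zero => exact stronglyMeasurable_const
    | succ k ih =>
      have hev : Measurable fun ω => g k ω (x k ω) :=
        ((isBoundedBilinearMap_apply (𝕜 := ℝ) (E := B) (F := ℝ)).continuous.comp_stronglyMeasurable
          (ih.prodMk (hx k))).measurable
      have : StronglyMeasurable fun ω =>
          (if 0 ≤ g k ω (x k ω) then (1 : ℝ) else -1) * (1 / 3 : ℝ) ^ k :=
        ((Measurable.ite (measurableSet_le measurable_const hev) measurable_const
          measurable_const).mul measurable_const).stronglyMeasurable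
      exact ih.add (this.smul (hf k))
  have hd : ∀ ω k, dist (g k ω) (g (k + 1) ω) ≤ 1 * (1 / 3 : ℝ) ^ k := by
    intro ω k
    rw [dist_comm, dist_eq_norm, hg, add_sub_cancel_left, norm_smul, norm_mul]
    have h1 : ‖(if 0 ≤ g k ω (x k ω) then (1 : ℝ) else -1)‖ = 1 := by split_ifs <;> simp
    rw [h1, one_mul, one_mul, Real.norm_of_nonneg (by positivity)]
    exact mul_le_of_le_one_right (by positivity) (hf1 k ω)
  have hlim : ∀ ω, ∃ h, Tendsto (fun k => g k ω) atTop (nhds h) := fun ω =>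
    cauchySeq_tendsto_of_complete (cauchySeq_of_le_geometric (1 / 3) 1 (by norm_num) (hd ω))
  choose h hh using hlim
  refine ⟨h, stronglyMeasurable_of_tendsto atTop hgm (tendsto_pi_nhds.2 hh), fun k ω => ?_⟩
  have h1 := dist_le_of_le_geometric_of_tendsto (1 / 3) 1 (by norm_num) (hd ω) (hh ω) (k + 1)
  rw [dist_eq_norm] at h1
  have h2 : |g (k + 1) ω (x k ω) - h ω (x k ω)| ≤ (1 / 3 : ℝ) ^ k / 2 * ‖x k ω‖ := by
    have := (g (k + 1) ω - h ω).le_opNorm (x k ω)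
    rw [Real.norm_eq_abs] at this
    refine this.trans (mul_le_mul_of_nonneg_right (h1.trans (le_of_eq ?_)) (norm_nonneg _))
    rw [pow_succ]; ring
  have hpk : (0 : ℝ) < (1 / 3 : ℝ) ^ k := by positivity
  have h3 : (1 / 3 : ℝ) ^ k * (‖x k ω‖ - 1) ≤ |g (k + 1) ω (x k ω)| := by
    have h4 := mul_le_mul_of_nonneg_left (hfx k ω) hpk.le
    rw [hg]
    simp only [add_apply, smul_apply, smul_eq_mul]
    split_ifs with hs
    · refine le_trans ?_ (le_abs_self _)
      linarith
    · refine le_trans ?_ (neg_le_abs _)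
      linarith
  have h5 := abs_sub_abs_le_abs_sub (g (k + 1) ω (x k ω)) (h ω (x k ω))
  linarith

/-- First-hitting selection: on `A`, where the members `v k` are unbounded above,
one may select a member of `G` for which the value is at least `r`. -/
lemma select [IsProbabilityMeasure P] {G : Set (Ω →ₘ[P] B)} (hcl : SeqClosed G)
    (hc : LConvex G) (x : ℕ → Ω →ₘ[P] B) (hx : ∀ n, x n ∈ G) (v : ℕ → Ω → ℝ)
    (hv : ∀ n, Measurable (v n)) (A : Set Ω) (hA : MeasurableSet A)
    (hunb : ∀ ω ∈ A, ¬ BddAbove (Set.range fun n => v n ω)) (r : ℝ) :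
    ∃ y ∈ G, ∀ᵐ ω ∂P, ω ∈ A → ∃ n, y ω = x n ω ∧ r ≤ v n ω := by
  have hp : ∀ ω, ∃ n, ω ∈ Aᶜ ∨ r ≤ v n ω := by
    intro ω
    by_cases h : ω ∈ A
    · by_contra! hcon
      exact hunb ω h ⟨r, by rintro _ ⟨n, rfl⟩; exact (hcon n).2.le⟩
    · exact ⟨0, Or.inl h⟩
  have hm : Measurable fun ω => Nat.find (hp ω) := measurable_find hp fun k =>
    hA.compl.union (measurableSet_le measurable_const (hv k))
  obtain ⟨y, hy, hy'⟩ := concat_seq hcl hc x hx _ hm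
  refine ⟨y, hy, ?_⟩
  filter_upwards [hy'] with ω h hω
  exact ⟨_, h, (Nat.find_spec (hp ω)).resolve_left fun h => h hω⟩

lemma ConvexlyCompact.asBounded [IsProbabilityMeasure P] {G : Set (Ω →ₘ[P] B)}
    (hG : ConvexlyCompact G) : ASBounded G := by
  obtain ⟨hne, hcl, hc, -⟩ := id hG
  obtain ⟨s, hs, hdom⟩ := exists_seq_dominating (nrm '' G) (hne.image _) (by
    rintro _ ⟨x, hx, rfl⟩ _ ⟨y, hy, rfl⟩
    obtain ⟨w, hw, hw'⟩ := concat_two hc hx hy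
      (measurableSet_le y.stronglyMeasurable.norm.measurable x.stronglyMeasurable.norm.measurable)
    refine ⟨nrm w, ⟨w, hw, rfl⟩, ?_, ?_⟩
    all_goals
      beta_reduce
      rw [← AEEqFun.coeFn_le]
      filter_upwards [nrm_coe x, nrm_coe y, nrm_coe w, hw'] with ω h1 h2 h3 h4
      simp only [h1, h2, h3, h4]
      split_ifs with h <;> first | exact le_rfl | linarith)
  choose x hx hxs using hs
  set A : Set Ω := {ω | BddAbove (Set.range fun n => s n ω)}ᶜ with hAdef
  have hA : MeasurableSet A := (measurableSet_bddAbove_range fun n => (s n).measurable).compl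
  by_cases hPA : P A = 0
  · have hm : AEStronglyMeasurable (fun ω => ⨆ n, s n ω) P :=
      (Measurable.iSup fun n => (s n).measurable).aestronglyMeasurable
    have hmk : ∀ᵐ ω ∂P, (AEEqFun.mk _ hm) ω = ⨆ n, s n ω := AEEqFun.coeFn_mk _ hm
    refine ⟨AEEqFun.mk _ hm, fun h hh => ?_⟩
    rw [← AEEqFun.coeFn_le]
    filter_upwards [hmk, hdom _ ⟨h, hh, rfl⟩, measure_eq_zero_iff_ae_notMem.1 hPA] with ω h1 h2 h3
    rw [h1]
    refine le_of_forall_lt fun c hc => ?_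
    obtain ⟨n, hn⟩ := h2 c hc
    exact hn.trans_le (le_ciSup (f := fun n => s n ω) (not_not.1 h3) n)
  exfalso
  -- members with large norm on `A`
  have h1 : ∀ k : ℕ, ∃ y ∈ G, ∀ᵐ ω ∂P, ω ∈ A → 2 + 2 * k * (3 : ℝ) ^ k ≤ ‖y ω‖ := by
    intro k
    obtain ⟨y, hy, hy'⟩ := select hcl hc x hx (fun n ω => s n ω) (fun n => (s n).measurable) A hA
      (fun ω h => h) (2 + 2 * k * (3 : ℝ) ^ k)
    refine ⟨y, hy, ?_⟩
    filter_upwards [hy', ae_all_iff.2 fun n => nrm_coe (x n)] with ω h1 h2 hω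
    obtain ⟨n, h3, h4⟩ := h1 hω
    rw [h3, ← h2 n, hxs n]
    exact h4
  choose y hy hy' using h1
  obtain ⟨h, hm, hbig⟩ := exists_functional (fun k => (y k : Ω → B))
    fun k => (y k).stronglyMeasurable
  have hev : ∀ k, Measurable fun ω => h ω (y k ω) := fun k =>
    ((isBoundedBilinearMap_apply (𝕜 := ℝ) (E := B) (F := ℝ)).continuous.comp_stronglyMeasurable
      (hm.prodMk (y k).stronglyMeasurable)).measurable
  set U : Set Ω := {ω | BddAbove (Set.range fun k => h ω (y k ω))} with hU
  have hUm : MeasurableSet U := measurableSet_bddAbove_range hev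
  set ρ : Ω → ℝ := fun ω => if ω ∈ U then -1 else 1 with hρ
  have hρm : Measurable ρ := Measurable.ite hUm measurable_const measurable_const
  set A' : Set Ω := {ω ∈ A | ¬ BddAbove (Set.range fun k => ρ ω * h ω (y k ω))} with hA'
  have hA'm : MeasurableSet A' :=
    hA.inter (measurableSet_bddAbove_range fun k => hρm.mul (hev k)).compl
  have hAA' : ∀ᵐ ω ∂P, ω ∈ A → ω ∈ A' := by
    filter_upwards [ae_all_iff.2 hy'] with ω h1 hω
    refine ⟨hω, fun hb => ?_⟩
    have hk : ∀ k : ℕ, (k : ℝ) ≤ |h ω (y k ω)| := by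
      intro k
      refine le_trans ?_ (hbig k ω)
      have h2 := h1 k hω
      have h3 : (1 / 3 : ℝ) ^ k * 3 ^ k = 1 := by rw [← mul_pow]; norm_num
      have h4 : (0 : ℝ) < (1 / 3 : ℝ) ^ k := by positivity
      calc (k : ℝ) = (1 / 3 : ℝ) ^ k * (k * 3 ^ k) := by
            rw [mul_left_comm, h3, mul_one]
        _ ≤ _ := mul_le_mul_of_nonneg_left (by linarith) h4.le
    by_cases hωU : ω ∈ U
    · obtain ⟨a, ha⟩ := id hωU
      obtain ⟨b, hb⟩ := hb
      obtain ⟨k, hk'⟩ := exists_nat_gt (max a b)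
      have h5 := ha ⟨k, rfl⟩
      have h6 := hb ⟨k, rfl⟩
      simp only [hρ, if_pos hωU] at h5 h6
      have h7 := hk k
      have := le_max_left a b
      have := le_max_right a b
      rcases abs_cases (h ω (y k ω)) with h8 | h8 <;> linarith
    · simp only [hρ, if_neg hωU, one_mul] at hb
      exact hωU hb
  -- the decreasing sequence of closed convex sets with empty intersection
  let C : ℕ → Set (Ω →ₘ[P] B) := fun n =>
    {z ∈ G | ∀ᵐ ω ∂P, ω ∈ A' → (n : ℝ) ≤ ρ ω * h ω (z ω)}
  obtain ⟨z, hz⟩ := hG.directed_inter C (fun n => by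
    refine ⟨?_, fun z hz => hz.1, ?_, ?_⟩
    · obtain ⟨z, hz, hz'⟩ := select hcl hc y hy (fun k ω => ρ ω * h ω (y k ω))
        (fun k => hρm.mul (hev k)) A' hA'm (fun ω h => h.2) n
      refine ⟨z, hz, ?_⟩
      filter_upwards [hz'] with ω h1 hω
      obtain ⟨k, h2, h3⟩ := h1 hω
      rw [h2]; exact h3
    · intro u w hu hlim
      refine ⟨hcl u w (fun n => (hu n).1) hlim, ?_⟩
      obtain ⟨ns, -, hns⟩ := hlim.exists_seq_tendsto_ae
      filter_upwards [hns, ae_all_iff.2 fun n => (hu n).2] with ω h1 h2 hω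
      have h3 : Tendsto (fun i => ρ ω * h ω (u (ns i) ω)) atTop (nhds (ρ ω * h ω (w ω))) :=
        (((h ω).continuous.tendsto _).comp h1).const_mul _
      exact ge_of_tendsto' h3 fun i => h2 _ hω
    · intro u hu w hw l h0 h1
      refine ⟨hc u hu.1 w hw.1 l h0 h1, ?_⟩
      filter_upwards [comb_coe l u w, zero_le_one_coe l h0 h1, hu.2, hw.2] with ω h2 h3 h4 h5 hω
      rw [h2, map_add, map_smul, map_smul, smul_eq_mul, smul_eq_mul]
      have h6 := mul_le_mul_of_nonneg_left (h4 hω) h3.1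
      have h7 := mul_le_mul_of_nonneg_left (h5 hω) (sub_nonneg.2 h3.2)
      linarith) (fun i j => by
    refine ⟨max i j, fun z hz => ⟨hz.1, ?_⟩, fun z hz => ⟨hz.1, ?_⟩⟩
    · filter_upwards [hz.2] with ω h1 hω
      exact (Nat.cast_le.2 (le_max_left i j)).trans (h1 hω)
    · filter_upwards [hz.2] with ω h1 hω
      exact (Nat.cast_le.2 (le_max_right i j)).trans (h1 hω))
  refine hPA (measure_eq_zero_iff_ae_notMem.2 ?_)
  filter_upwards [ae_all_iff.2 fun n => (hz n).2, hAA'] with ω h1 h2 hω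
  obtain ⟨n, hn⟩ := exists_nat_gt (ρ ω * h ω (z ω))
  exact absurd (h1 n (h2 hω)) (not_le.2 hn)

/-! ### The asymptotic radius -/

section radius

variable [IsProbabilityMeasure P] {G : Set (Ω →ₘ[P] B)} {T : (Ω →ₘ[P] B) → (Ω →ₘ[P] B)}

lemma iter_subset (hmaps : Set.MapsTo T G G) (m : ℕ) : T^[m] '' G ⊆ G := by
  rintro _ ⟨x, hx, rfl⟩
  exact hmaps.iterate m hx

lemma Rr_isLUB (hb : ASBounded G) {H : Set (Ω →ₘ[P] B)} (hH : H ⊆ G) (hne : H.Nonempty)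
    (x : Ω →ₘ[P] B) : IsLUB ((fun y => nrm (x - y)) '' H) (Rr H x) := by
  refine lsup_isLUB _ (hne.image _) ?_
  obtain ⟨ξ, hξ⟩ := hb
  refine ⟨nrm x + ξ, ?_⟩
  rintro _ ⟨y, hy, rfl⟩
  rw [← AEEqFun.coeFn_le]
  filter_upwards [nrm_sub_coe x y, nrm_coe x, nrm_coe y, AEEqFun.coeFn_add (nrm x) ξ,
    AEEqFun.coeFn_le.2 (hξ y (hH hy))] with ω h1 h2 h3 h4 h5
  rw [h1, h4, Pi.add_apply, h2]
  have := norm_sub_le (x ω) (y ω)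
  linarith

lemma nrm_nonneg (x : Ω →ₘ[P] B) : 0 ≤ nrm x := by
  rw [← AEEqFun.coeFn_le]
  filter_upwards [nrm_coe x, AEEqFun.coeFn_zero (α := Ω) (μ := P) (β := ℝ)] with ω h1 h2
  rw [h1, h2]
  exact norm_nonneg _

lemma Rr_nonneg (hb : ASBounded G) {H : Set (Ω →ₘ[P] B)} (hH : H ⊆ G) (hne : H.Nonempty)
    (x : Ω →ₘ[P] B) : 0 ≤ Rr H x := by
  obtain ⟨y, hy⟩ := hne
  exact (nrm_nonneg _).trans ((Rr_isLUB hb hH ⟨y, hy⟩ x).1 ⟨y, hy, rfl⟩)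

lemma asympR_isGLB (hb : ASBounded G) (hne : G.Nonempty) (hmaps : Set.MapsTo T G G)
    (x : Ω →ₘ[P] B) : IsGLB {ξ | ∃ m : ℕ, ξ = Rr (T^[m + 1] '' G) x} (asympR G T x) := by
  refine linf_isGLB _ ⟨_, 0, rfl⟩ ⟨0, ?_⟩
  rintro _ ⟨m, rfl⟩
  exact Rr_nonneg hb (iter_subset hmaps _) (hne.image _) x

lemma asympRS_isGLB (hb : ASBounded G) (hne : G.Nonempty) (hmaps : Set.MapsTo T G G) :
    IsGLB ((fun x => asympR G T x) '' G) (asympRS G T) := by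
  refine linf_isGLB _ (hne.image _) ⟨0, ?_⟩
  rintro _ ⟨x, hx, rfl⟩
  refine (asympR_isGLB hb hne hmaps x).2 ?_
  rintro _ ⟨m, rfl⟩
  exact Rr_nonneg hb (iter_subset hmaps _) (hne.image _) x

/-- The asymptotic radius is 1-Lipschitz. -/
lemma asympR_lip (hb : ASBounded G) (hne : G.Nonempty) (hmaps : Set.MapsTo T G G)
    (x y : Ω →ₘ[P] B) :
    ∀ᵐ ω ∂P, asympR G T x ω ≤ asympR G T y ω + ‖x ω - y ω‖ := by
  have h1 : asympR G T x - nrm (x - y) ≤ asympR G T y := by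
    refine (asympR_isGLB hb hne hmaps y).2 ?_
    rintro _ ⟨m, rfl⟩
    have h2 := (asympR_isGLB hb hne hmaps x).1 ⟨m, rfl⟩
    have h3 : Rr (T^[m + 1] '' G) x ≤ Rr (T^[m + 1] '' G) y + nrm (x - y) := by
      refine (Rr_isLUB hb (iter_subset hmaps _) (hne.image _) x).2 ?_
      rintro _ ⟨z, hz, rfl⟩
      have h4 := (Rr_isLUB hb (iter_subset hmaps _) (hne.image _) y).1 ⟨z, hz, rfl⟩
      rw [← AEEqFun.coeFn_le] at h4 ⊢
      filter_upwards [h4, nrm_sub_coe x z, nrm_sub_coe y z, nrm_sub_coe x y,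
        AEEqFun.coeFn_add (Rr (T^[m + 1] '' G) y) (nrm (x - y))] with ω h5 h6 h7 h8 h9
      rw [h6, h9, Pi.add_apply, h8]
      rw [h7] at h5
      have := norm_sub_le_norm_sub_add_norm_sub (x ω) (y ω) (z ω)
      linarith
    have h4 := h2.trans h3
    rw [← AEEqFun.coeFn_le] at h4 ⊢
    filter_upwards [h4, AEEqFun.coeFn_add (Rr (T^[m + 1] '' G) y) (nrm (x - y)),
      AEEqFun.coeFn_sub (asympR G T x) (nrm (x - y))] with ω h5 h6 h7
    rw [h7, Pi.sub_apply]
    rw [h6, Pi.add_apply] at h5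
    linarith
  rw [← AEEqFun.coeFn_le] at h1
  filter_upwards [h1, nrm_sub_coe x y, AEEqFun.coeFn_sub (asympR G T x) (nrm (x - y))]
    with ω h2 h3 h4
  rw [h4, Pi.sub_apply, h3] at h2
  linarith

lemma le_sup_of_glb {S : Set (Ω →ₘ[P] ℝ)} {a b c : Ω →ₘ[P] ℝ} (hb : IsGLB S b)
    (h : ∀ s ∈ S, a ≤ s ⊔ c) : a ≤ b ⊔ c := by
  have key : a - (b ⊔ c - b) ≤ b := by
    refine hb.2 fun s hs => ?_
    have h1 := h s hs
    have h2 := hb.1 hs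
    rw [← AEEqFun.coeFn_le] at h1 h2 ⊢
    filter_upwards [h1, h2, AEEqFun.coeFn_sub a (b ⊔ c - b), AEEqFun.coeFn_sub (b ⊔ c) b,
      AEEqFun.coeFn_sup b c, AEEqFun.coeFn_sup s c] with ω h1 h2 h3 h4 h5 h6
    rw [h3, Pi.sub_apply, h4, Pi.sub_apply, h5]
    rw [h6] at h1
    rcases le_total (s ω) (c ω) with h7 | h7
    · rw [sup_eq_right.2 h7] at h1
      have : c ω ≤ b ω ⊔ c ω := le_sup_right
      linarith
    · rw [sup_eq_left.2 h7] at h1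
      have : b ω ≤ b ω ⊔ c ω := le_sup_left
      linarith
  rw [← AEEqFun.coeFn_le] at key ⊢
  filter_upwards [key, AEEqFun.coeFn_sub a (b ⊔ c - b), AEEqFun.coeFn_sub (b ⊔ c) b]
    with ω h1 h2 h3
  rw [h2, Pi.sub_apply, h3, Pi.sub_apply] at h1
  linarith

lemma Rr_mono (hb : ASBounded G) {H K : Set (Ω →ₘ[P] B)} (hHK : H ⊆ K) (hK : K ⊆ G)
    (hne : H.Nonempty) (x : Ω →ₘ[P] B) : Rr H x ≤ Rr K x := by
  refine (Rr_isLUB hb (hHK.trans hK) hne x).2 ?_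
  rintro _ ⟨z, hz, rfl⟩
  exact (Rr_isLUB hb hK (hne.mono hHK) x).1 ⟨z, hHK hz, rfl⟩

lemma iter_anti (hmaps : Set.MapsTo T G G) {m n : ℕ} (h : m ≤ n) :
    T^[n] '' G ⊆ T^[m] '' G := by
  rintro _ ⟨x, hx, rfl⟩
  refine ⟨T^[n - m] x, hmaps.iterate _ hx, ?_⟩
  rw [← Function.iterate_add_apply, Nat.add_sub_cancel' h]

/-- Quasi-convexity of the asymptotic radius. -/
lemma asympR_quasi (hb : ASBounded G) (hne : G.Nonempty) (hmaps : Set.MapsTo T G G)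
    (x y : Ω →ₘ[P] B) (l : Ω →ₘ[P] ℝ) (h0 : 0 ≤ l) (h1 : l ≤ 1) :
    asympR G T (msmul l x + msmul (1 - l) y) ≤ asympR G T x ⊔ asympR G T y := by
  refine le_sup_of_glb (asympR_isGLB hb hne hmaps x) ?_
  rintro _ ⟨m, rfl⟩
  rw [sup_comm]
  refine le_sup_of_glb (asympR_isGLB hb hne hmaps y) ?_
  rintro _ ⟨k, rfl⟩
  have hmk1 : m + 1 ≤ max m k + 1 := by omega
  have hmk2 : k + 1 ≤ max m k + 1 := by omega
  refine ((asympR_isGLB hb hne hmaps _).1 ⟨max m k, rfl⟩).trans ?_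
  refine (Rr_isLUB hb (iter_subset hmaps _) (hne.image _) _).2 ?_
  rintro _ ⟨z, hz, rfl⟩
  have h2 := (Rr_isLUB hb (iter_subset hmaps _) (hne.image _) x).1
    ⟨z, iter_anti hmaps hmk1 hz, rfl⟩
  have h3 := (Rr_isLUB hb (iter_subset hmaps _) (hne.image _) y).1
    ⟨z, iter_anti hmaps hmk2 hz, rfl⟩
  rw [← AEEqFun.coeFn_le] at h2 h3 ⊢
  filter_upwards [h2, h3, nrm_sub_coe x z, nrm_sub_coe y z,
    nrm_sub_coe (msmul l x + msmul (1 - l) y) z, comb_coe l x y, zero_le_one_coe l h0 h1,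
    AEEqFun.coeFn_sup (Rr (T^[k + 1] '' G) y) (Rr (T^[m + 1] '' G) x)]
    with ω h2 h3 h4 h5 h6 h7 h8 h9
  rw [h4] at h2
  rw [h5] at h3
  rw [h9, h6, h7]
  have e : l ω • x ω + (1 - l ω) • y ω - z ω =
      l ω • (x ω - z ω) + (1 - l ω) • (y ω - z ω) := by module
  rw [e]
  set M := Rr (T^[k + 1] '' G) y ω ⊔ Rr (T^[m + 1] '' G) x ω
  have h10 : ‖x ω - z ω‖ ≤ M := h2.trans le_sup_right
  have h11 : ‖y ω - z ω‖ ≤ M := h3.trans le_sup_left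
  refine (norm_add_le _ _).trans ?_
  rw [norm_smul, norm_smul, Real.norm_of_nonneg h8.1, Real.norm_of_nonneg (sub_nonneg.2 h8.2)]
  have h12 := mul_le_mul_of_nonneg_left h10 h8.1
  have h13 := mul_le_mul_of_nonneg_left h11 (sub_nonneg.2 h8.2)
  linarith

/-- Sublevel sets of the asymptotic radius are closed and `L⁰`-convex. -/
lemma sublevel (hG : ConvexlyCompact G) (hmaps : Set.MapsTo T G G) (η : Ω →ₘ[P] ℝ) :
    SeqClosed {x ∈ G | asympR G T x ≤ η} ∧ LConvex {x ∈ G | asympR G T x ≤ η} := by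
  have hb := hG.asBounded
  obtain ⟨hne, hcl, hc, -⟩ := hG
  constructor
  · intro u w hu hlim
    refine ⟨hcl u w (fun n => (hu n).1) hlim, ?_⟩
    obtain ⟨ns, -, hns⟩ := hlim.exists_seq_tendsto_ae
    rw [← AEEqFun.coeFn_le]
    filter_upwards [hns, ae_all_iff.2 fun n => AEEqFun.coeFn_le.2 (hu n).2,
      ae_all_iff.2 fun n => asympR_lip hb hne hmaps w (u n)] with ω h1 h2 h3
    have h4 : Tendsto (fun i => η ω + ‖w ω - u (ns i) ω‖) atTop (nhds (η ω + ‖w ω - w ω‖)) :=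
      ((tendsto_const_nhds.sub h1).norm).const_add _
    rw [sub_self, norm_zero, add_zero] at h4
    refine ge_of_tendsto' h4 fun i => ?_
    have := h2 (ns i)
    have := h3 (ns i)
    linarith
  · intro u hu w hw l h0 h1
    exact ⟨hc u hu.1 w hw.1 l h0 h1,
      (asympR_quasi hb hne hmaps u w l h0 h1).trans (sup_le hu.2 hw.2)⟩

end radius

/-- For an `L⁰`-convexly compact `G` and a nonexpansive `T : G → G`, the random asymptotic
center of `{T^m(G) : m ∈ ℕ}` with respect to `G` is a nonempty closed `L⁰`-convex subset of
`G` which is `T`-invariant. -/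
theorem asympC_nonempty_closed_convex_invariant
    [IsProbabilityMeasure P] [CompleteSpace B]
    (G : Set (Ω →ₘ[P] B)) (hG : ConvexlyCompact G)
    (T : (Ω →ₘ[P] B) → (Ω →ₘ[P] B)) (hmaps : Set.MapsTo T G G)
    (hnonexp : NonexpansiveOn G T) :
    (asympC G T).Nonempty ∧ SeqClosed (asympC G T) ∧ LConvex (asympC G T) ∧
      asympC G T ⊆ G ∧ Set.MapsTo T (asympC G T) (asympC G T) := by
  have hb := hG.asBounded
  have hne := hG.1
  have hS := asympRS_isGLB hb hne hmaps
  have hAC : asympC G T = {x ∈ G | asympR G T x ≤ asympRS G T} := by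
    ext x
    refine and_congr_right fun hx => ⟨fun h => h.le, fun h => le_antisymm h (hS.1 ⟨x, hx, rfl⟩)⟩
  have hsub := sublevel hG hmaps (asympRS G T)
  refine ⟨?_, hAC ▸ hsub.1, hAC ▸ hsub.2, fun x hx => hx.1, ?_⟩
  · have : Nonempty G := hne.to_subtype
    obtain ⟨z, hz⟩ := hG.directed_inter
      (fun x : G => {z ∈ G | asympR G T z ≤ asympR G T x.1})
      (fun x => ⟨⟨x.1, x.2, le_rfl⟩, fun z hz => hz.1, sublevel hG hmaps _⟩) (by
      rintro ⟨x, hx⟩ ⟨y, hy⟩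
      obtain ⟨w, hw, hw'⟩ := concat_two hG.2.2.1 hx hy
        (measurableSet_le (asympR G T x).measurable (asympR G T y).measurable)
      have hwx : asympR G T w ≤ asympR G T x ∧ asympR G T w ≤ asympR G T y := by
        constructor
        all_goals
          rw [← AEEqFun.coeFn_le]
          filter_upwards [hw', asympR_lip hb hne hmaps w x, asympR_lip hb hne hmaps w y]
            with ω h1 h2 h3
          by_cases h : asympR G T x ω ≤ asympR G T y ω
          · rw [if_pos h] at h1
            rw [h1, sub_self, norm_zero, add_zero] at h2
            linarith
          · rw [if_neg h] at h1
            rw [h1, sub_self, norm_zero, add_zero] at h3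
            linarith
      exact ⟨⟨w, hw⟩, fun z hz => ⟨hz.1, hz.2.trans hwx.1⟩, fun z hz => ⟨hz.1, hz.2.trans hwx.2⟩⟩)
    rw [hAC]
    obtain ⟨x₀, hx₀⟩ := hne
    refine ⟨z, (hz ⟨x₀, hx₀⟩).1, hS.2 ?_⟩
    rintro _ ⟨x, hx, rfl⟩
    exact (hz ⟨x, hx⟩).2
  · rw [hAC]
    rintro x ⟨hx, hxle⟩
    refine ⟨hmaps hx, le_trans ((asympR_isGLB hb hne hmaps x).2 ?_) hxle⟩
    rintro _ ⟨m, rfl⟩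
    refine ((asympR_isGLB hb hne hmaps (T x)).1 ⟨m + 1, rfl⟩).trans ?_
    refine (Rr_isLUB hb (iter_subset hmaps _) (hne.image _) _).2 ?_
    rintro _ ⟨_, ⟨z, hz, rfl⟩, rfl⟩
    rw [Function.iterate_succ_apply']
    refine (hnonexp x hx _ (hmaps.iterate (m + 1) hz)).trans ?_
    exact (Rr_isLUB hb (iter_subset hmaps _) (hne.image _) x).1 ⟨_, ⟨z, hz, rfl⟩, rfl⟩

end RNM
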